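/- Let X be an Abelian group and Y a β-homogeneous F-space with 0 < β ≤ 1. Let C > 0, let ω be an integer, let α, γ be real numbers with |α+γ|^β + |α−γ|^β < 1, and let f : X → Y satisfy ‖f(x) − α·f(ω•x) + γ·f(−ω•x)‖ ≤ C for all x ∈ X. Define A_0 = 1, B_0 = 0, A_{n+1} = α·A_n + γ·B_n, B_{n+1} = γ·A_n + α·B_n, and g_n(x) = A_n·f(ω^n • x) − B_n·f(−ω^n • x). Then for every x ∈ X the limit g(x) := lim_{n→∞} g_n(x) exists in Y, and the mapping g : X → Y satisfies ‖f(x) − g(x)‖ ≤ C·(∑_{n=1}^∞ (|A_n|^β + |B_n|^β) + 1) for all x ∈ X. -/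

import Mathlib

theorem abs_rpow_le_add_of_two_mul_abs_le {a p q β : ℝ} (hβ : 0 ≤ β)
    (h : 2 * |a| ≤ |p| + |q|) : |a| ^ β ≤ |p| ^ β + |q| ^ β := by
  have hp : 0 ≤ |p| ^ β := Real.rpow_nonneg (abs_nonneg p) β
  have hq : 0 ≤ |q| ^ β := Real.rpow_nonneg (abs_nonneg q) β
  rcases le_total |p| |q| with hpq | hpq
  · have := Real.rpow_le_rpow (abs_nonneg a) (by linarith : |a| ≤ |q|) hβ
    linarith
  · have := Real.rpow_le_rpow (abs_nonneg a) (by linarith : |a| ≤ |p|) hβ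
    linarith

theorem summable_abs_pow_rpow {p β : ℝ} (hp : |p| ^ β < 1) :
    Summable fun n : ℕ => |p ^ n| ^ β := by
  have h : (fun n : ℕ => |p ^ n| ^ β) = fun n : ℕ => (|p| ^ β) ^ n := by
    funext n
    rw [abs_pow, Real.rpow_pow_comm (abs_nonneg p)]
  rw [h]
  exact summable_geometric_of_lt_one (Real.rpow_nonneg (abs_nonneg p) β) hp

theorem summable_abs_rpow_add_abs_rpow_of_linear_recurrence {α γ β : ℝ} (hβ : 0 ≤ β)
    (hp : |α + γ| ^ β < 1) (hq : |α - γ| ^ β < 1) {A B : ℕ → ℝ}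
    (hA0 : A 0 = 1) (hB0 : B 0 = 0)
    (hA : ∀ n : ℕ, A (n + 1) = α * A n + γ * B n)
    (hB : ∀ n : ℕ, B (n + 1) = γ * A n + α * B n) :
    Summable fun n : ℕ => |A n| ^ β + |B n| ^ β := by
  have hadd : ∀ n, A n + B n = (α + γ) ^ n := by
    intro n
    induction n with
    | zero => simp [hA0, hB0]
    | succ n ih => rw [hA, hB, pow_succ, ← ih]; ring
  have hsub : ∀ n, A n - B n = (α - γ) ^ n := by
    intro n
    induction n with
    | zero => simp [hA0, hB0]
    | succ n ih => rw [hA, hB, pow_succ, ← ih]; ring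
  have hgeom := (summable_abs_pow_rpow hp).add (summable_abs_pow_rpow hq)
  refine Summable.add
    (hgeom.of_nonneg_of_le (fun n => Real.rpow_nonneg (abs_nonneg _) β) fun n => ?_)
    (hgeom.of_nonneg_of_le (fun n => Real.rpow_nonneg (abs_nonneg _) β) fun n => ?_)
  · apply abs_rpow_le_add_of_two_mul_abs_le hβ
    calc 2 * |A n| = |(α + γ) ^ n + (α - γ) ^ n| := by
          rw [← hadd, ← hsub, ← abs_two, ← abs_mul]; ring_nf
      _ ≤ _ := abs_add_le _ _
  · apply abs_rpow_le_add_of_two_mul_abs_le hβ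
    calc 2 * |B n| = |(α + γ) ^ n - (α - γ) ^ n| := by
          rw [← hadd, ← hsub, ← abs_two, ← abs_mul]; ring_nf
      _ ≤ _ := abs_sub _ _

theorem stmt_5 {X Y : Type*} [AddCommGroup X]
    [AddCommGroup Y] [Module ℝ Y] [MetricSpace Y] [CompleteSpace Y]
    (β : ℝ) (hβ0 : 0 < β) (hβ1 : β ≤ 1)
    (N : Y → ℝ)
    (hN_nonneg : ∀ y : Y, 0 ≤ N y)
    (hN_eq_zero : ∀ y : Y, N y = 0 ↔ y = 0)
    (hN_add : ∀ y z : Y, N (y + z) ≤ N y + N z)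
    (hN_smul : ∀ (t : ℝ) (y : Y), N (t • y) = |t| ^ β * N y)
    (hdist : ∀ y z : Y, dist y z = N (y - z))
    (C : ℝ) (hC : 0 < C) (ω : ℤ) (α γ : ℝ)
    (hαγ : |α + γ| ^ β + |α - γ| ^ β < 1)
    (f : X → Y)
    (hf : ∀ x : X, N (f x - α • f (ω • x) + γ • f ((-ω) • x)) ≤ C)
    (A B : ℕ → ℝ)
    (hA0 : A 0 = 1) (hB0 : B 0 = 0)
    (hA : ∀ n : ℕ, A (n + 1) = α * A n + γ * B n)
    (hB : ∀ n : ℕ, B (n + 1) = γ * A n + α * B n)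
    (g : ℕ → X → Y)
    (hg : ∀ (n : ℕ) (x : X),
      g n x = A n • f ((ω ^ n) • x) - B n • f ((-(ω ^ n)) • x)) :
    ∃ G : X → Y,
      (∀ x : X, Filter.Tendsto (fun n : ℕ => g n x) Filter.atTop (nhds (G x))) ∧
      (∀ x : X,
        N (f x - G x) ≤ C * ((∑' n : ℕ, (|A (n + 1)| ^ β + |B (n + 1)| ^ β)) + 1)) := by
  have hp : |α + γ| ^ β < 1 := by
    linarith [Real.rpow_nonneg (abs_nonneg (α - γ)) β]
  have hq : |α - γ| ^ β < 1 := by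
    linarith [Real.rpow_nonneg (abs_nonneg (α + γ)) β]
  have hsum := summable_abs_rpow_add_abs_rpow_of_linear_recurrence hβ0.le hp hq hA0 hB0 hA hB
  have hstep : ∀ x n, dist (g n x) (g (n + 1) x) ≤ C * (|A n| ^ β + |B n| ^ β) := by
    intro x n
    have hpos : ω • (ω ^ n • x) = ω ^ (n + 1) • x := by rw [smul_smul, pow_succ']
    have hneg : (-ω) • (ω ^ n • x) = (-(ω ^ (n + 1))) • x := by
      rw [neg_smul, hpos, neg_smul]
    have hpos' : ω • ((-(ω ^ n)) • x) = (-(ω ^ (n + 1))) • x := by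
      rw [neg_smul, smul_neg, hpos, neg_smul]
    have hneg' : (-ω) • ((-(ω ^ n)) • x) = ω ^ (n + 1) • x := by
      rw [neg_smul, neg_smul, smul_neg, neg_neg, hpos]
    have h₁ := hf (ω ^ n • x)
    have h₂ := hf ((-(ω ^ n)) • x)
    rw [hpos, hneg] at h₁
    rw [hpos', hneg'] at h₂
    have hsplit : g n x - g (n + 1) x =
        A n • (f (ω ^ n • x) - α • f (ω ^ (n + 1) • x) + γ • f ((-(ω ^ (n + 1))) • x)) +
        (-B n) • (f ((-(ω ^ n)) • x) - α • f ((-(ω ^ (n + 1))) • x) +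
          γ • f (ω ^ (n + 1) • x)) := by
      rw [hg, hg, hA, hB]
      module
    rw [hdist, hsplit]
    refine (hN_add _ _).trans ?_
    rw [hN_smul, hN_smul, abs_neg]
    have h₃ := mul_le_mul_of_nonneg_left h₁ (Real.rpow_nonneg (abs_nonneg (A n)) β)
    have h₄ := mul_le_mul_of_nonneg_left h₂ (Real.rpow_nonneg (abs_nonneg (B n)) β)
    linarith
  have hsumC := hsum.mul_left C
  choose G hG using fun x =>
    cauchySeq_tendsto_of_complete (cauchySeq_of_dist_le_of_summable _ (hstep x) hsumC)
  refine ⟨G, hG, fun x => ?_⟩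
  have hbound := dist_le_tsum_of_dist_le_of_tendsto₀ _ (hstep x) hsumC (hG x)
  have hg0 : g 0 x = f x := by simp [hg, hA0, hB0]
  rw [hg0, hdist, tsum_mul_left, hsum.tsum_eq_zero_add] at hbound
  have hzero : |A 0| ^ β + |B 0| ^ β = 1 := by
    simp [hA0, hB0, Real.zero_rpow hβ0.ne']
  rwa [hzero, add_comm 1] at hbound
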